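/- arXiv:0907.5192 — 3 statements merged into one kernel-verified Lean document; each statement's English description precedes it below -/
import Mathlib

section
/- Let k ≥ 1, let p, q be complex numbers with p + q = 1, q ≠ 0, p ≠ q, set τ = p/q, and let ρ be a complex number. Let ξ_1, …, ξ_k be complex numbers such that p + q·ξ_i·ξ_j − ξ_i ≠ 0 for all i ≠ j, ξ_i − 1 + ρ(1−τ) ≠ 0 for all i, and for every nonempty subset T ⊆ {1,…,k} one has ∏_{j∈T} ξ_j − (1 − ρ + τ^{|T|} ρ) ≠ 0. Then the symmetrization identity holds: ∑_{σ ∈ S_k} ∏_{i<j} (ξ_{σ(j)} − ξ_{σ(i)})/(p + q·ξ_{σ(i)}·ξ_{σ(j)} − ξ_{σ(i)}) · ∏_{i=1}^{k} 1/(ξ_{σ(i)}·ξ_{σ(i+1)}⋯ξ_{σ(k)} − 1 + ρ − τ^{k−i+1}ρ) = q^{k(k−1)/2} · ∏_{i≠j} (ξ_j − ξ_i)/(p + q·ξ_i·ξ_j − ξ_i) · ∏_{i=1}^{k} 1/(ξ_i − 1 + ρ(1−τ)). -/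
open Finset

open Polynomial in
/-- Lagrange interpolation of `(X - 1 + ρ (1 - τ)) ∏ y ∈ s, (p - y + q y X)` at the nodes
`s ∪ {1, τ}`, read off at the top coefficient. -/
theorem sum_prod_div_sub_of_notMem {p q ρ τ : ℂ} (hpq : p + q = 1) (hq : q ≠ 0)
    (hp : p = q * τ) (hτ1 : τ ≠ 1) (s : Finset ℂ) (h1 : 1 ∉ s) (hτ : τ ∉ s) :
    (∑ x ∈ s, (x - 1 + ρ * (1 - τ)) * ∏ y ∈ s.erase x, (p + q * y * x - y) / (x - y)) * q =
      q ^ #s * (∏ x ∈ s, x - 1 + ρ - τ ^ #s * ρ) := by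
  set P : ℂ[X] := (X + C (ρ * (1 - τ) - 1)) * ∏ y ∈ s, (C (q * y) * X + C (p - y)) with hP
  have hlin (y : ℂ) : (C (q * y) * X + C (p - y)).natDegree ≤ 1 := natDegree_linear_le
  have hdeg : (∏ y ∈ s, (C (q * y) * X + C (p - y))).natDegree ≤ #s :=
    (natDegree_prod_le _ _).trans <| by simpa using sum_le_card_nsmul s _ 1 fun y _ => hlin y
  have hprod : (∏ y ∈ s, (C (q * y) * X + C (p - y))).coeff #s = q ^ #s * ∏ x ∈ s, x := by
    rw [← prod_const, ← prod_mul_distrib]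
    simpa using
      coeff_prod_of_natDegree_le s (fun y => C (q * y) * X + C (p - y)) 1 fun y _ => hlin y
  have hcoeff : P.coeff (1 + #s) = q ^ #s * ∏ x ∈ s, x := by
    rw [hP, coeff_mul_add_eq_of_natDegree_le (natDegree_X_add_C _).le hdeg, hprod]
    simp [coeff_one]
  have hτ1s : τ ∉ insert 1 s := by simp [hτ1, hτ]
  have hcard : #(insert τ (insert 1 s)) = #s + 2 := by
    rw [card_insert_of_notMem hτ1s, card_insert_of_notMem h1]
  have hPdeg : P.degree < #(insert τ (insert 1 s)) := by
    rw [hcard]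
    refine degree_le_natDegree.trans_lt ?_
    have := natDegree_mul_le_of_le (natDegree_X_add_C (ρ * (1 - τ) - 1)).le hdeg
    rw [← hP] at this
    exact_mod_cast (by omega : P.natDegree < #s + 2)
  have key := Lagrange.coeff_eq_sum (v := id) Function.injective_id.injOn hPdeg
  rw [hcard, show #s + 2 - 1 = 1 + #s by omega, hcoeff, sum_insert hτ1s, sum_insert h1] at key
  have heval (x : ℂ) : P.eval x = (x - 1 + ρ * (1 - τ)) * ∏ y ∈ s, (p + q * y * x - y) := by
    simp only [hP, eval_mul, eval_add, eval_X, eval_C, eval_prod]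
    congr 1
    · ring
    · exact prod_congr rfl fun y _ => by ring
  have hne1 : (1 - τ) ≠ 0 := sub_ne_zero.2 hτ1.symm
  have hneτ : (τ - 1) ≠ 0 := sub_ne_zero.2 hτ1
  have hτterm : P.eval (id τ) / ∏ j ∈ (insert τ (insert 1 s)).erase τ, (id τ - id j) =
      (1 - ρ) * q ^ #s := by
    have h0 : ∏ y ∈ s, (τ - y) ≠ 0 :=
      prod_ne_zero_iff.2 fun y hy => sub_ne_zero.2 fun h => hτ (h ▸ hy)
    rw [erase_insert hτ1s, prod_insert h1, heval]
    have : ∏ y ∈ s, (p + q * y * τ - y) = q ^ #s * ∏ y ∈ s, (τ - y) := by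
      rw [← prod_const, ← prod_mul_distrib]
      refine prod_congr rfl fun y _ => ?_
      linear_combination (1 - y) * hp + y * hpq
    simp only [id, this]
    field_simp
    ring
  have h1term : P.eval (id 1) / ∏ j ∈ (insert τ (insert 1 s)).erase 1, (id 1 - id j) =
      ρ * (q ^ #s * τ ^ #s) := by
    have h0 : ∏ y ∈ s, (1 - y) ≠ 0 :=
      prod_ne_zero_iff.2 fun y hy => sub_ne_zero.2 fun h => h1 (h ▸ hy)
    rw [erase_insert_of_ne hτ1, erase_insert h1, prod_insert hτ, heval]
    have : ∏ y ∈ s, (p + q * y * 1 - y) = (q ^ #s * τ ^ #s) * ∏ y ∈ s, (1 - y) := by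
      rw [← mul_pow, ← hp, ← prod_const, ← prod_mul_distrib]
      refine prod_congr rfl fun y _ => ?_
      linear_combination y * hpq
    simp only [id, this]
    field_simp
    ring
  have hsum : ∑ x ∈ s, P.eval (id x) / ∏ j ∈ (insert τ (insert 1 s)).erase x, (id x - id j) =
      (∑ x ∈ s, (x - 1 + ρ * (1 - τ)) * ∏ y ∈ s.erase x, (p + q * y * x - y) / (x - y)) * q := by
    rw [sum_mul]
    refine sum_congr rfl fun x hx => ?_
    have hx1 : x ≠ 1 := fun h => h1 (h ▸ hx)
    have hxτ : x ≠ τ := fun h => hτ (h ▸ hx)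
    have h0 : ∏ y ∈ s.erase x, (x - y) ≠ 0 :=
      prod_ne_zero_iff.2 fun y hy => sub_ne_zero.2 (ne_of_mem_erase hy).symm
    rw [erase_insert_of_ne hxτ.symm, erase_insert_of_ne hx1.symm, prod_insert (by simp [hτ1, hτ]),
      prod_insert (by simp [h1]), heval, ← mul_prod_erase s _ hx, prod_div_distrib]
    have hx1' := sub_ne_zero.2 hx1
    have hxτ' := sub_ne_zero.2 hxτ
    have : p + q * x * x - x = q * ((x - τ) * (x - 1)) := by
      linear_combination (1 - x) * hp + x * hpq
    simp only [id, this]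
    field_simp
  rw [hτterm, h1term, hsum] at key
  linear_combination -key

/-- The restriction `1, τ ∉ s` in `sum_prod_div_sub_of_notMem` is removed by translating `s`
and using continuity. -/
theorem sum_prod_div_sub {p q ρ τ : ℂ} (hpq : p + q = 1) (hq : q ≠ 0)
    (hp : p = q * τ) (hτ1 : τ ≠ 1) (s : Finset ℂ) :
    (∑ x ∈ s, (x - 1 + ρ * (1 - τ)) * ∏ y ∈ s.erase x, (p + q * y * x - y) / (x - y)) * q =
      q ^ #s * (∏ x ∈ s, x - 1 + ρ - τ ^ #s * ρ) := by
  let f (t : ℂ) : ℂ := (∑ x ∈ s, (x + t - 1 + ρ * (1 - τ)) *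
    ∏ y ∈ s.erase x, (p + q * (y + t) * (x + t) - (y + t)) / (x - y)) * q
  let g (t : ℂ) : ℂ := q ^ #s * (∏ x ∈ s, (x + t) - 1 + ρ - τ ^ #s * ρ)
  have hf : Continuous f := by
    simp only [f, div_eq_mul_inv]
    fun_prop
  have hg : Continuous g := by fun_prop
  have hdense : Dense (((s.image (1 - ·) ∪ s.image (τ - ·) : Finset ℂ) : Set ℂ)ᶜ) :=
    (Finset.countable_toSet _).dense_compl ℂ
  have hfg : f = g := by
    refine hf.ext_on hdense hg fun t ht => ?_
    have ht' : ∀ x ∈ s, x + t ≠ 1 ∧ x + t ≠ τ := fun x hx =>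
      ⟨fun h => ht (by simpa using Or.inl ⟨x, hx, by linear_combination -h⟩),
        fun h => ht (by simpa using Or.inr ⟨x, hx, by linear_combination -h⟩)⟩
    have := sum_prod_div_sub_of_notMem (ρ := ρ) hpq hq hp hτ1 (s.map (addRightEmbedding t))
      (by simpa using fun x hx => (ht' x hx).1) (by simpa using fun x hx => (ht' x hx).2)
    have herase (x : ℂ) : (s.map (addRightEmbedding t)).erase (x + t) =
        (s.erase x).map (addRightEmbedding t) := (map_erase _ _ _).symm
    simpa only [f, g, sum_map, prod_map, herase, card_map, addRightEmbedding_apply,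
      add_sub_add_right_eq_sub] using this
  simpa [f, g] using congrFun hfg 0

theorem prod_offDiag_succ {n : ℕ} {M : Type*} [CommMonoid M]
    (f : Fin (n + 1) → Fin (n + 1) → M) :
    ∏ i, ∏ j ∈ univ.filter (fun j => j ≠ i), f i j =
      ((∏ j : Fin n, f 0 j.succ) * ∏ j : Fin n, f j.succ 0) *
        ∏ i : Fin n, ∏ j ∈ univ.filter (fun j => j ≠ i), f i.succ j.succ := by
  simp only [prod_filter, Fin.prod_univ_succ, ne_eq, not_true_eq_false, if_false, one_mul,
    Fin.succ_ne_zero, not_false_eq_true, if_true, (Fin.succ_ne_zero _).symm, Fin.succ_inj,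
    prod_mul_distrib, mul_assoc]
  exact mul_left_comm _ _ _

theorem prod_lt_succ {n : ℕ} {M : Type*} [CommMonoid M]
    (f : Fin (n + 1) → Fin (n + 1) → M) :
    ∏ i, ∏ j ∈ univ.filter (fun j => i < j), f i j =
      (∏ j : Fin n, f 0 j.succ) *
        ∏ i : Fin n, ∏ j ∈ univ.filter (fun j => i < j), f i.succ j.succ := by
  simp [prod_filter, Fin.prod_univ_succ]

theorem prod_swap_zero_succ {n : ℕ} {M : Type*} [CommMonoid M] (m : Fin (n + 1))
    (f : Fin (n + 1) → M) :
    ∏ j : Fin n, f (Equiv.swap 0 m j.succ) = ∏ j ∈ univ.erase m, f j := by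
  refine prod_bij (fun j _ => Equiv.swap 0 m j.succ) (fun j _ => ?_) (fun i _ j _ h => ?_)
    (fun j hj => ?_) fun j _ => rfl
  · rw [mem_erase, ne_eq, Equiv.swap_apply_eq_iff, Equiv.swap_apply_right]
    exact ⟨Fin.succ_ne_zero j, mem_univ _⟩
  · simpa using h
  · have : Equiv.swap 0 m j ≠ 0 := by
      rw [ne_eq, Equiv.swap_apply_eq_iff, Equiv.swap_apply_left]
      exact ne_of_mem_erase hj
    obtain ⟨i, hi⟩ := Fin.exists_succ_eq.2 this
    exact ⟨i, mem_univ _, by simp [hi]⟩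

theorem prod_offDiag_comp_perm {α M : Type*} [Fintype α] [DecidableEq α] [CommMonoid M]
    (e : Equiv.Perm α) (f : α → α → M) :
    ∏ i, ∏ j ∈ univ.filter (fun j => j ≠ i), f (e i) (e j) =
      ∏ i, ∏ j ∈ univ.filter (fun j => j ≠ i), f i j := by
  simp only [prod_filter]
  rw [← Equiv.prod_comp e fun i => ∏ j, if j ≠ i then f i j else 1]
  refine prod_congr rfl fun i _ => ?_
  rw [← Equiv.prod_comp e fun j => if j ≠ e i then f (e i) j else 1]
  simp

theorem sum_prod_div_sub_fin {p q ρ τ : ℂ} (hpq : p + q = 1) (hq : q ≠ 0)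
    (hp : p = q * τ) (hτ1 : τ ≠ 1) {n : ℕ} (ξ : Fin (n + 1) → ℂ) (hξ : Function.Injective ξ) :
    ∑ m, (ξ m - 1 + ρ * (1 - τ)) *
        ∏ j ∈ univ.erase m, (p + q * ξ j * ξ m - ξ j) / (ξ m - ξ j) =
      q ^ n * (∏ j, ξ j - 1 + ρ - τ ^ (n + 1) * ρ) := by
  have := sum_prod_div_sub (ρ := ρ) hpq hq hp hτ1 (univ.map ⟨ξ, hξ⟩)
  have herase (m : Fin (n + 1)) : (univ.map ⟨ξ, hξ⟩).erase (ξ m) =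
      (univ.erase m).map ⟨ξ, hξ⟩ := (map_erase ⟨ξ, hξ⟩ _ _).symm
  simp only [sum_map, prod_map, Function.Embedding.coeFn_mk, herase, card_map, card_univ,
    Fintype.card_fin] at this
  refine mul_right_cancel₀ hq (this.trans ?_)
  ring

/-- The symmetrization identity for distinct `ξ i`, by induction on `k`, splitting the sum over
permutations according to the value at `0`. -/
theorem sum_perm_prod_of_injective {p q ρ τ : ℂ} (hpq : p + q = 1) (hq : q ≠ 0)
    (hp : p = q * τ) (hτ1 : τ ≠ 1) (k : ℕ) (ξ : Fin k → ℂ) (hξ : Function.Injective ξ)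
    (h1 : ∀ i j : Fin k, i ≠ j → p + q * ξ i * ξ j - ξ i ≠ 0)
    (h2 : ∀ i : Fin k, ξ i - 1 + ρ * (1 - τ) ≠ 0)
    (h3 : ∀ T : Finset (Fin k), T.Nonempty →
      (∏ j ∈ T, ξ j) - (1 - ρ + τ ^ T.card * ρ) ≠ 0) :
    ∑ σ : Equiv.Perm (Fin k),
      (∏ i : Fin k, ∏ j ∈ univ.filter (fun j => i < j),
        ((ξ (σ j) - ξ (σ i)) / (p + q * ξ (σ i) * ξ (σ j) - ξ (σ i)))) *
        (∏ i : Fin k,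
          (1 / ((∏ l ∈ univ.filter (fun l => i ≤ l), ξ (σ l)) - 1 + ρ
              - τ ^ (k - (i : ℕ)) * ρ))) =
      q ^ (k * (k - 1) / 2) *
        (∏ i : Fin k, ∏ j ∈ univ.filter (fun j => j ≠ i),
          ((ξ j - ξ i) / (p + q * ξ i * ξ j - ξ i))) *
        ∏ i : Fin k, (1 / (ξ i - 1 + ρ * (1 - τ))) := by
  induction k with
  | zero => simp
  | succ n ih =>
  set G : ℂ := q ^ ((n + 1) * (n + 1 - 1) / 2) *
        (∏ i : Fin (n + 1), ∏ j ∈ univ.filter (fun j => j ≠ i),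
          ((ξ j - ξ i) / (p + q * ξ i * ξ j - ξ i))) *
        ∏ i : Fin (n + 1), (1 / (ξ i - 1 + ρ * (1 - τ))) with hG
  have hD : ∏ j, ξ j - 1 + ρ - τ ^ (n + 1) * ρ ≠ 0 := by
    have := h3 univ univ_nonempty
    rw [card_univ, Fintype.card_fin] at this
    intro h
    exact this (by linear_combination h)
  have hterm (m : Fin (n + 1)) : ∑ σ : Equiv.Perm (Fin n),
      (∏ i : Fin (n + 1), ∏ j ∈ univ.filter (fun j => i < j),
        ((ξ (Equiv.Perm.decomposeFin.symm (m, σ) j) - ξ (Equiv.Perm.decomposeFin.symm (m, σ) i)) /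
          (p + q * ξ (Equiv.Perm.decomposeFin.symm (m, σ) i) *
            ξ (Equiv.Perm.decomposeFin.symm (m, σ) j) -
              ξ (Equiv.Perm.decomposeFin.symm (m, σ) i)))) *
        (∏ i : Fin (n + 1),
          (1 / ((∏ l ∈ univ.filter (fun l => i ≤ l), ξ (Equiv.Perm.decomposeFin.symm (m, σ) l))
            - 1 + ρ - τ ^ (n + 1 - (i : ℕ)) * ρ))) =
      G / (q ^ n * (∏ j, ξ j - 1 + ρ - τ ^ (n + 1) * ρ)) * ((ξ m - 1 + ρ * (1 - τ)) *
        ∏ j ∈ univ.erase m, (p + q * ξ j * ξ m - ξ j) / (ξ m - ξ j)) := by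
    set η : Fin n → ℂ := fun i => ξ (Equiv.swap 0 m i.succ) with hη
    have hinj : Function.Injective fun i : Fin n => Equiv.swap 0 m i.succ :=
      (Equiv.injective _).comp (Fin.succ_injective n)
    have hne (i : Fin n) : Equiv.swap 0 m i.succ ≠ m := by
      rw [ne_eq, Equiv.swap_apply_eq_iff, Equiv.swap_apply_right]
      exact Fin.succ_ne_zero i
    have ih' := ih η (hξ.comp hinj) (fun i j hij => h1 _ _ (hinj.ne hij)) (fun i => h2 _)
      fun T hT => by
        simpa using h3 (T.map ⟨_, hinj⟩) (hT.map)
    have hGm : G = q ^ n * ((∏ j, (η j - ξ m) / (p + q * ξ m * η j - ξ m)) *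
        ∏ j, (ξ m - η j) / (p + q * η j * ξ m - η j)) * (1 / (ξ m - 1 + ρ * (1 - τ))) *
        (q ^ (n * (n - 1) / 2) *
        (∏ i : Fin n, ∏ j ∈ univ.filter (fun j => j ≠ i),
          ((η j - η i) / (p + q * η i * η j - η i))) *
        ∏ i : Fin n, (1 / (η i - 1 + ρ * (1 - τ)))) := by
      have hexp : (n + 1) * (n + 1 - 1) / 2 = n + n * (n - 1) / 2 := by
        rw [Nat.triangle_succ, add_comm]
      rw [hG, hexp, ← prod_offDiag_comp_perm (Equiv.swap 0 m), prod_offDiag_succ,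
        ← Equiv.prod_comp (Equiv.swap 0 m) fun i => 1 / (ξ i - 1 + ρ * (1 - τ)), Fin.prod_univ_succ,
        Equiv.swap_apply_left, pow_add]
      ring
    have hC : (∏ j, (ξ m - η j) / (p + q * η j * ξ m - η j)) *
        ∏ j ∈ univ.erase m, (p + q * ξ j * ξ m - ξ j) / (ξ m - ξ j) = 1 := by
      rw [← prod_swap_zero_succ m, ← prod_mul_distrib]
      refine prod_eq_one fun j _ => ?_
      have e1 : ξ m - η j ≠ 0 := sub_ne_zero.2 (hξ.ne (hne j).symm)
      have e2 : p + q * η j * ξ m - η j ≠ 0 := h1 _ _ (hne j)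
      change (ξ m - η j) / (p + q * η j * ξ m - η j) *
        ((p + q * η j * ξ m - η j) / (ξ m - η j)) = 1
      rw [div_mul_div_cancel₀ e2, div_self e1]
    have hsplit (σ : Equiv.Perm (Fin n)) :
        (∏ i : Fin (n + 1),
          (1 / ((∏ l ∈ univ.filter (fun l => i ≤ l), ξ (Equiv.Perm.decomposeFin.symm (m, σ) l))
            - 1 + ρ - τ ^ (n + 1 - (i : ℕ)) * ρ))) =
        1 / (∏ j, ξ j - 1 + ρ - τ ^ (n + 1) * ρ) * ∏ i : Fin n,
          (1 / ((∏ l ∈ univ.filter (fun l => i ≤ l), η (σ l)) - 1 + ρ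
              - τ ^ (n - (i : ℕ)) * ρ)) := by
      rw [Fin.prod_univ_succ]
      congr 1
      · simp [Equiv.prod_comp (Equiv.Perm.decomposeFin.symm (m, σ)) ξ]
      · refine prod_congr rfl fun i _ => ?_
        simp [prod_filter, Fin.prod_univ_succ, hη]
    simp only [hsplit, prod_lt_succ, Equiv.Perm.decomposeFin_symm_apply_zero,
      Equiv.Perm.decomposeFin_symm_apply_succ]
    have hA (σ : Equiv.Perm (Fin n)) :
        ∏ j, (η (σ j) - ξ m) / (p + q * ξ m * η (σ j) - ξ m) =
          ∏ j, (η j - ξ m) / (p + q * ξ m * η j - ξ m) :=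
      Equiv.prod_comp σ fun j => (η j - ξ m) / (p + q * ξ m * η j - ξ m)
    change ∑ σ : Equiv.Perm (Fin n), (∏ j, (η (σ j) - ξ m) / (p + q * ξ m * η (σ j) - ξ m)) *
      (∏ i : Fin n, ∏ j ∈ univ.filter (fun j => i < j),
        ((η (σ j) - η (σ i)) / (p + q * η (σ i) * η (σ j) - η (σ i)))) * _ = _
    simp only [hA]
    simp only [mul_mul_mul_comm _ _ (1 / (∏ j, ξ j - 1 + ρ - τ ^ (n + 1) * ρ)), ← mul_sum]
    rw [ih', hGm]
    have he := h2 m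
    have hqn : q ^ n ≠ 0 := pow_ne_zero _ hq
    generalize ∏ j ∈ univ.erase m, (p + q * ξ j * ξ m - ξ j) / (ξ m - ξ j) = E at hC ⊢
    generalize ∏ j, (ξ m - η j) / (p + q * η j * ξ m - η j) = K at hC ⊢
    generalize ∏ j, (η j - ξ m) / (p + q * ξ m * η j - ξ m) = A
    generalize q ^ (n * (n - 1) / 2) * _ * _ = R
    generalize ∏ j, ξ j - 1 + ρ - τ ^ (n + 1) * ρ = D at hD ⊢
    generalize ξ m - 1 + ρ * (1 - τ) = e at he ⊢
    field_simp
    linear_combination -(A * R) * hC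
  rw [← Equiv.Perm.decomposeFin.symm.sum_comp, Fintype.sum_prod_type]
  simp only [hterm]
  rw [← mul_sum, sum_prod_div_sub_fin hpq hq hp hτ1 ξ hξ]
  exact div_mul_cancel₀ _ (mul_ne_zero (pow_ne_zero _ hq) hD)

/-- The symmetrization identity from §IV of Tracy–Widom, "On ASEP with Step
Bernoulli Initial Condition":
`∑_{σ ∈ S_k} ∏_{i<j} (ξ_{σj} - ξ_{σi})/(p + q ξ_{σi} ξ_{σj} - ξ_{σi})
   ∏_i 1/(ξ_{σi} ⋯ ξ_{σk} - 1 + ρ - τ^{k-i+1} ρ)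
 = q^{k(k-1)/2} ∏_{i≠j} (ξ_j - ξ_i)/(p + q ξ_i ξ_j - ξ_i)
   ∏_i 1/(ξ_i - 1 + ρ(1-τ))`. -/
theorem symmetrization_identity_step_bernoulli
    (k : ℕ) (hk : 1 ≤ k) (p q ρ : ℂ) (hpq : p + q = 1) (hq : q ≠ 0)
    (hpneq : p ≠ q) (τ : ℂ) (hτ : τ = p / q) (ξ : Fin k → ℂ)
    (h1 : ∀ i j : Fin k, i ≠ j → p + q * ξ i * ξ j - ξ i ≠ 0)
    (h2 : ∀ i : Fin k, ξ i - 1 + ρ * (1 - τ) ≠ 0)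
    (h3 : ∀ T : Finset (Fin k), T.Nonempty →
      (∏ j ∈ T, ξ j) - (1 - ρ + τ ^ T.card * ρ) ≠ 0) :
    ∑ σ : Equiv.Perm (Fin k),
      (∏ i : Fin k, ∏ j ∈ univ.filter (fun j => i < j),
        ((ξ (σ j) - ξ (σ i)) / (p + q * ξ (σ i) * ξ (σ j) - ξ (σ i)))) *
        (∏ i : Fin k,
          (1 / ((∏ l ∈ univ.filter (fun l => i ≤ l), ξ (σ l)) - 1 + ρ
              - τ ^ (k - (i : ℕ)) * ρ))) =
      q ^ (k * (k - 1) / 2) *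
        (∏ i : Fin k, ∏ j ∈ univ.filter (fun j => j ≠ i),
          ((ξ j - ξ i) / (p + q * ξ i * ξ j - ξ i))) *
        ∏ i : Fin k, (1 / (ξ i - 1 + ρ * (1 - τ))) := by
  have hp : p = q * τ := by rw [hτ, mul_div_cancel₀ _ hq]
  have hτ1 : τ ≠ 1 := by
    rintro rfl
    exact hpneq (by rw [hp, mul_one])
  by_cases hξ : Function.Injective ξ
  · exact sum_perm_prod_of_injective hpq hq hp hτ1 k ξ hξ h1 h2 h3
  obtain ⟨a, b, hab, hne⟩ := Function.not_injective_iff.1 hξ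
  have hR : ∏ i : Fin k, ∏ j ∈ univ.filter (fun j => j ≠ i),
      ((ξ j - ξ i) / (p + q * ξ i * ξ j - ξ i)) = 0 :=
    prod_eq_zero (mem_univ b) <| prod_eq_zero (i := a) (by simpa using hne) (by simp [hab])
  rw [hR, mul_zero, zero_mul]
  refine sum_eq_zero fun σ _ => mul_eq_zero_of_left ?_ _
  obtain h | h := (σ.symm.injective.ne hne).lt_or_gt
  · exact prod_eq_zero (mem_univ _) <|
      prod_eq_zero (mem_filter.2 ⟨mem_univ _, h⟩) (by simp [hab])
  · exact prod_eq_zero (mem_univ _) <|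
      prod_eq_zero (mem_filter.2 ⟨mem_univ _, h⟩) (by simp [hab])
end

section
/- Let ρ and τ be real numbers with ρ ≠ 1, and let S = {s_1 < s_2 < ⋯ < s_k} be a set of positive integers with k ≥ 1 elements; set s_0 = 0 and t_i = s_i − s_{i−1} − 1 for i = 1,…,k. Then ∑_{Y_1 : S ⊆ Y_1 ⊆ {1,…,s_k}} (ρ/(1−ρ))^{|Y_1|} τ^{σ(S,Y_1)} = τ^{k(k+1)/2} · (ρ/(1−ρ))^{k} · ∏_{i=1}^{k} (1 + τ^{k−i+1} · ρ/(1−ρ))^{t_i}, where the sum is over all subsets Y_1 of {1,…,s_k} containing S. -/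
open Finset

/-- `sigmaPairs U V = σ(U,V)` is the number of pairs `(u,v)` with `u ∈ U`,
`v ∈ V` and `u ≥ v`. -/
def sigmaPairs (U V : Finset ℕ) : ℕ :=
  ((U ×ˢ V).filter (fun p => p.2 ≤ p.1)).card

theorem sigmaPairs_eq_sum (U V : Finset ℕ) :
    sigmaPairs U V = ∑ v ∈ V, (U.filter (v ≤ ·)).card := by
  simp only [sigmaPairs, Finset.card_filter]
  rw [Finset.sum_product_right]

theorem pow_card_mul_pow_sigmaPairs {R : Type*} [CommSemiring R] (x τ : R) (U V : Finset ℕ) :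
    x ^ V.card * τ ^ sigmaPairs U V = ∏ v ∈ V, τ ^ (U.filter (v ≤ ·)).card * x := by
  rw [sigmaPairs_eq_sum, Finset.prod_mul_distrib, Finset.prod_pow_eq_pow_sum, Finset.prod_const,
    mul_comm]

theorem sum_prod_powerset_filter_subset {ι R : Type*} [DecidableEq ι] [CommSemiring R]
    {S I : Finset ι} (hSI : S ⊆ I) (f : ι → R) :
    ∑ Y ∈ I.powerset.filter (fun Y => S ⊆ Y), ∏ v ∈ Y, f v =
      ∏ v ∈ I, (f v + if v ∈ S then 0 else 1) := by
  rw [Finset.prod_add, Finset.sum_filter]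
  refine Finset.sum_congr rfl fun Y _ => ?_
  split_ifs with h
  · rw [Finset.prod_eq_one fun v hv => if_neg fun hvS => (Finset.mem_sdiff.1 hv).2 (h hvS),
      mul_one]
  · obtain ⟨v, hvS, hvY⟩ := Finset.not_subset.1 h
    have hzero : ∏ w ∈ I \ Y, (if w ∈ S then (0 : R) else 1) = 0 :=
      Finset.prod_eq_zero (i := v) (Finset.mem_sdiff.2 ⟨hSI hvS, hvY⟩) (by rw [if_pos hvS])
    rw [hzero, mul_zero]

theorem lt_of_forall_lt_succ {s : ℕ → ℕ} {k : ℕ} (hmono : ∀ i, i < k → s i < s (i + 1))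
    {i j : ℕ} (hij : i < j) (hj : j ≤ k) : s i < s j := by
  induction j, hij using Nat.le_induction with
  | base => exact hmono i hj
  | succ j _ ih => exact (ih (by omega)).trans (hmono j hj)

theorem card_filter_le_image_Icc {s : ℕ → ℕ} {k : ℕ} (hmono : ∀ i, i < k → s i < s (i + 1))
    {m v : ℕ} (hm : m < k) (hv : s m < v) (hv' : v ≤ s (m + 1)) :
    (((Finset.Icc 1 k).image s).filter (v ≤ ·)).card = k - m := by
  have hlt := fun {i j : ℕ} => lt_of_forall_lt_succ hmono (i := i) (j := j)
  have himage : ((Finset.Icc 1 k).image s).filter (v ≤ ·) = (Finset.Icc (m + 1) k).image s := by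
    rw [Finset.filter_image]
    congr 1
    ext i
    simp only [Finset.mem_filter, Finset.mem_Icc]
    constructor
    · rintro ⟨⟨_, hi⟩, hvi⟩
      refine ⟨?_, hi⟩
      by_contra! h
      rcases (Nat.lt_succ_iff.1 h).eq_or_lt with rfl | h'
      · omega
      · have := hlt h' hm.le
        omega
    · rintro ⟨hmi, hi⟩
      refine ⟨⟨by omega, hi⟩, ?_⟩
      rcases hmi.eq_or_lt with rfl | h'
      · exact hv'
      · have := hlt h' hi
        omega
  rw [himage, Finset.card_image_of_injOn, Nat.card_Icc]
  · omega
  · intro i hi j hj hij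
    simp only [Finset.coe_Icc, Set.mem_Icc] at hi hj
    rcases lt_trichotomy i j with h | h | h
    · exact absurd hij (hlt h hj.2).ne
    · exact h
    · exact absurd hij (hlt h hi.2).ne'

theorem notMem_image_of_between {s : ℕ → ℕ} {k : ℕ} (hmono : ∀ i, i < k → s i < s (i + 1))
    {m v : ℕ} (hm : m < k) (hv : s m < v) (hv' : v < s (m + 1)) :
    v ∉ (Finset.Icc 1 k).image s := by
  have hlt := fun {i j : ℕ} => lt_of_forall_lt_succ hmono (i := i) (j := j)
  simp only [Finset.mem_image, Finset.mem_Icc, not_exists, not_and]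
  rintro i ⟨_, hi⟩ rfl
  rcases lt_trichotomy i m with h | rfl | h
  · exact absurd hv (hlt h hm.le).le.not_gt
  · exact hv.false
  · rcases (Nat.succ_le_of_lt h).eq_or_lt with rfl | h'
    · exact hv'.false
    · exact absurd hv' (hlt h' hi).le.not_gt

/-- The product over `[1, s_m]` splits into the blocks `(s_{i-1}, s_i]`. -/
theorem prod_Ioc_eq_prod_blocks {R : Type*} [CommSemiring R] (x τ : R) {s : ℕ → ℕ} {k : ℕ}
    (hs0 : s 0 = 0) (hmono : ∀ i, i < k → s i < s (i + 1)) {m : ℕ} (hm : m ≤ k) :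
    ∏ v ∈ Finset.Ioc 0 (s m),
        (τ ^ (((Finset.Icc 1 k).image s).filter (v ≤ ·)).card * x +
          if v ∈ (Finset.Icc 1 k).image s then 0 else 1) =
      ∏ i ∈ Finset.Icc 1 m,
        (τ ^ (k - i + 1) * x * (1 + τ ^ (k - i + 1) * x) ^ (s i - s (i - 1) - 1)) := by
  induction m with
  | zero => simp [hs0]
  | succ m ih =>
    have hlt := hmono m hm
    have hk : k - (m + 1) + 1 = k - m := by omega
    rw [← Finset.prod_Ioc_consecutive _ (Nat.zero_le (s m)) hlt.le, ih (by omega),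
      Finset.prod_Icc_succ_top (by omega)]
    congr 1
    rw [← Finset.Ioo_insert_right hlt, Finset.prod_insert Finset.right_notMem_Ioo,
      if_pos (Finset.mem_image_of_mem s (Finset.mem_Icc.2 ⟨by omega, hm⟩)), add_zero,
      card_filter_le_image_Icc hmono hm hlt le_rfl, hk, Nat.add_sub_cancel]
    congr 1
    rw [← Nat.card_Ioo]
    refine Finset.prod_eq_pow_card fun v hv => ?_
    rw [Finset.mem_Ioo] at hv
    rw [if_neg (notMem_image_of_between hmono hm hv.1 hv.2),
      card_filter_le_image_Icc hmono hm hv.1 hv.2.le, add_comm]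

theorem sum_Icc_reflect (k : ℕ) : ∑ i ∈ Finset.Icc 1 k, (k - i + 1) = k * (k + 1) / 2 := by
  have h : ∑ i ∈ Finset.Icc 1 k, (k - i + 1) = ∑ i ∈ Finset.range (k + 1), i := by
    rw [Finset.sum_range_succ', add_zero]
    refine Finset.sum_nbij' (fun i => k - i) (fun i => k - i) ?_ ?_ ?_ ?_ ?_ <;>
      intro i hi <;> simp only [Finset.mem_Icc, Finset.mem_range] at hi ⊢ <;> omega
  rw [h, Finset.sum_range_id, Nat.add_sub_cancel, mul_comm]

/-- The first factor in (8) of §II of Tracy–Widom, "On ASEP with Step Bernoulli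
Initial Condition": for `S = {s_1 < ⋯ < s_k}` positive integers (with `s_0 = 0`
and gaps `t_i = s_i - s_{i-1} - 1`),
`∑_{S ⊆ Y₁ ⊆ [1,s_k]} (ρ/(1-ρ))^{|Y₁|} τ^{σ(S,Y₁)}
  = τ^{k(k+1)/2} (ρ/(1-ρ))^k ∏_{i=1}^{k} (1 + τ^{k-i+1} ρ/(1-ρ))^{t_i}`. -/
theorem bernoulli_gap_sum_identity
    (ρ τ : ℝ) (hρ : ρ ≠ 1) (k : ℕ) (hk : 1 ≤ k)
    (s : ℕ → ℕ) (hs0 : s 0 = 0) (hmono : ∀ i, i < k → s i < s (i + 1))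
    (S : Finset ℕ) (hS : S = (Finset.Icc 1 k).image s)
    (t : ℕ → ℕ) (ht : ∀ i, t i = s i - s (i - 1) - 1) :
    ∑ Y₁ ∈ (Finset.Icc 1 (s k)).powerset.filter (fun Y₁ => S ⊆ Y₁),
        (ρ / (1 - ρ)) ^ Y₁.card * τ ^ sigmaPairs S Y₁ =
      τ ^ (k * (k + 1) / 2) * (ρ / (1 - ρ)) ^ k *
        ∏ i ∈ Finset.Icc 1 k, (1 + τ ^ (k - i + 1) * (ρ / (1 - ρ))) ^ t i := by
  subst hS
  have hsub : (Finset.Icc 1 k).image s ⊆ Finset.Icc 1 (s k) := by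
    intro v hv
    obtain ⟨i, hi, rfl⟩ := Finset.mem_image.1 hv
    rw [Finset.mem_Icc] at hi ⊢
    have hpos := lt_of_forall_lt_succ hmono (Nat.lt_of_succ_le hi.1) hi.2
    refine ⟨by omega, ?_⟩
    rcases hi.2.eq_or_lt with rfl | h
    · exact le_rfl
    · exact (lt_of_forall_lt_succ hmono h le_rfl).le
  simp only [pow_card_mul_pow_sigmaPairs, ht]
  rw [sum_prod_powerset_filter_subset hsub]
  have hIcc : Finset.Icc 1 (s k) = Finset.Ioc 0 (s k) := rfl
  rw [hIcc, prod_Ioc_eq_prod_blocks _ _ hs0 hmono le_rfl, Finset.prod_mul_distrib,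
    Finset.prod_mul_distrib, Finset.prod_pow_eq_pow_sum, sum_Icc_reflect, Finset.prod_const,
    Nat.card_Icc, Nat.add_sub_cancel]
end

section
/- Let m ≥ 1 and let τ, λ be complex numbers with 0 < |τ| < 1 and |λ| > |τ|^{1−m}. Then the series ∑_{k=m}^{∞} [k−1 choose k−m]_τ · τ^{(1−m)k} · λ^{−k} converges and (−1)^{m} · τ^{m(m−1)/2} · ∑_{k=m}^{∞} [k−1 choose k−m]_τ · τ^{(1−m)k} · λ^{−k} = ∏_{j=0}^{m−1} 1/(1 − λ τ^{j}). -/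
open Finset

/-- The τ-binomial coefficient
`[N choose n]_τ = (1-τ^N)(1-τ^{N-1})⋯(1-τ^{N-n+1}) / ((1-τ)(1-τ^2)⋯(1-τ^n))`. -/
noncomputable def tBinom (τ : ℂ) (N n : ℕ) : ℂ :=
  (∏ j ∈ Finset.range n, (1 - τ ^ (N - j))) /
    (∏ j ∈ Finset.range n, (1 - τ ^ (j + 1)))

theorem one_sub_pow_succ_ne_zero {τ : ℂ} (hτ : ‖τ‖ < 1) (j : ℕ) : 1 - τ ^ (j + 1) ≠ 0 := by
  intro h
  have h1 : ‖τ ^ (j + 1)‖ = 1 := by rw [← sub_eq_zero.mp h, norm_one]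
  rw [norm_pow] at h1
  exact (pow_lt_one₀ (norm_nonneg τ) hτ j.succ_ne_zero).ne h1

theorem tBinom_add_eq_prod (τ : ℂ) (n j : ℕ) :
    tBinom τ (n + j) j =
      (∏ i ∈ range j, (1 - τ ^ (n + 1 + i))) / ∏ i ∈ range j, (1 - τ ^ (i + 1)) := by
  unfold tBinom
  congr 1
  rw [← prod_range_reflect]
  refine prod_congr rfl fun i hi => ?_
  have := mem_range.mp hi
  congr 2
  omega

theorem tBinom_self {τ : ℂ} (hτ : ‖τ‖ < 1) (j : ℕ) : tBinom τ j j = 1 := by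
  have h := tBinom_add_eq_prod τ 0 j
  simp only [zero_add] at h
  rw [h]
  simp only [add_comm 1]
  exact div_self (prod_ne_zero_iff.mpr fun i _ => one_sub_pow_succ_ne_zero hτ i)

theorem tBinom_pascal {τ : ℂ} (hτ : ‖τ‖ < 1) (n j : ℕ) :
    tBinom τ (n + 1 + (j + 1)) (j + 1) =
      tBinom τ (n + (j + 1)) (j + 1) + τ ^ (n + 1) * tBinom τ (n + 1 + j) j := by
  have hd : ∏ i ∈ range j, (1 - τ ^ (i + 1)) ≠ 0 :=
    prod_ne_zero_iff.mpr fun i _ => one_sub_pow_succ_ne_zero hτ i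
  have hj := one_sub_pow_succ_ne_zero hτ j
  have hshift : ∏ i ∈ range (j + 1), (1 - τ ^ (n + 1 + i)) =
      (∏ i ∈ range j, (1 - τ ^ (n + 1 + 1 + i))) * (1 - τ ^ (n + 1)) := by
    rw [prod_range_succ']
    simp only [add_zero, add_assoc, add_comm 1]
  rw [tBinom_add_eq_prod, tBinom_add_eq_prod, tBinom_add_eq_prod, hshift,
    prod_range_succ, prod_range_succ]
  field_simp
  ring

theorem eq_sum_range_of_succ_eq {R : Type*} [CommRing R] {a c : ℕ → R} {r : R}
    (h0 : a 0 = c 0) (hs : ∀ j, a (j + 1) = c (j + 1) + r * a j) (j : ℕ) :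
    a j = ∑ i ∈ range (j + 1), c i * r ^ (j - i) := by
  induction j with
  | zero => simp [h0]
  | succ j ih =>
    rw [hs, ih, sum_range_succ _ (j + 1), mul_sum]
    simp only [Nat.sub_self, pow_zero, mul_one]
    rw [add_comm]
    congr 1
    refine sum_congr rfl fun i hi => ?_
    rw [Nat.succ_sub (Nat.le_of_lt_succ (mem_range.mp hi)), pow_succ]
    ring

/-- The `τ`-binomial series `∑ [n+j choose j]_τ z^j = ∏_{i ≤ n} 1 / (1 - z τ^i)`. -/
theorem tBinom_series {τ z : ℂ} (hτ : ‖τ‖ < 1) (hz : ‖z‖ < 1) (n : ℕ) :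
    Summable (fun j : ℕ => ‖tBinom τ (n + j) j * z ^ j‖) ∧
      ∑' j : ℕ, tBinom τ (n + j) j * z ^ j = ∏ i ∈ range (n + 1), (1 - z * τ ^ i)⁻¹ := by
  induction n with
  | zero =>
    simp only [zero_add, tBinom_self hτ, one_mul, prod_range_one, pow_zero, mul_one]
    exact ⟨summable_norm_geometric_of_norm_lt_one hz, tsum_geometric_of_norm_lt_one hz⟩
  | succ n ih =>
    obtain ⟨hsum, htsum⟩ := ih
    have hr : ‖z * τ ^ (n + 1)‖ < 1 := by
      rw [norm_mul, norm_pow]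
      exact mul_lt_one_of_nonneg_of_lt_one_left (norm_nonneg z) hz
        (pow_le_one₀ (norm_nonneg τ) hτ.le)
    have hgeom := summable_norm_geometric_of_norm_lt_one hr
    have hrec : (fun j : ℕ => tBinom τ (n + 1 + j) j * z ^ j) = fun j =>
        ∑ i ∈ range (j + 1), tBinom τ (n + i) i * z ^ i * (z * τ ^ (n + 1)) ^ (j - i) := by
      funext j
      refine eq_sum_range_of_succ_eq (a := fun j : ℕ => tBinom τ (n + 1 + j) j * z ^ j)
        (c := fun j : ℕ => tBinom τ (n + j) j * z ^ j) (by simp [tBinom]) (fun j => ?_) j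
      simp only [tBinom_pascal hτ n j]
      ring
    refine ⟨?_, ?_⟩
    · simp only [congrFun hrec]
      exact summable_norm_sum_mul_range_of_summable_norm hsum hgeom
    · rw [hrec, ← tsum_mul_tsum_eq_tsum_sum_range_of_summable_norm hsum hgeom, htsum,
        tsum_geometric_of_norm_lt_one hr, prod_range_succ _ (n + 1)]

/-- Reversal of the product `∏ 1 / (1 - λ τ^j)` under `λ = (τ^n z)⁻¹`. -/
theorem prod_one_div_one_sub_inv_mul {K : Type*} [Field K] {τ z : K} (hτ : τ ≠ 0) (hz : z ≠ 0)
    (n : ℕ) :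
    ∏ j ∈ range (n + 1), 1 / (1 - (τ ^ n * z)⁻¹ * τ ^ j) =
      (-1) ^ (n + 1) * τ ^ ((n + 1) * n / 2) * z ^ (n + 1) *
        ∏ i ∈ range (n + 1), (1 - z * τ ^ i)⁻¹ := by
  have hpow : τ ^ ((n + 1) * n / 2) = ∏ i ∈ range (n + 1), τ ^ i := by
    rw [prod_pow_eq_pow_sum, sum_range_id, Nat.add_sub_cancel]
  have hconst : (-1 : K) ^ (n + 1) * z ^ (n + 1) = ∏ _i ∈ range (n + 1), (-z) := by
    rw [prod_const, card_range, ← mul_pow, neg_one_mul]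
  rw [mul_right_comm ((-1 : K) ^ (n + 1)), hconst, hpow, ← prod_mul_distrib, ← prod_mul_distrib,
    ← prod_range_reflect]
  refine prod_congr rfl fun i hi => ?_
  have hi' : i ≤ n := Nat.le_of_lt_succ (mem_range.mp hi)
  have hsplit : τ ^ n = τ ^ (n - i) * τ ^ i := by rw [← pow_add, Nat.sub_add_cancel hi']
  have hfac : 1 - (τ ^ n * z)⁻¹ * τ ^ (n - i) = (-z * τ ^ i)⁻¹ * (1 - z * τ ^ i) := by
    rw [hsplit]
    field_simp
    ring
  rw [show n + 1 - 1 - i = n - i by omega, hfac, one_div, mul_inv, inv_inv]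

/-- The λ-series identity from §IV of Tracy–Widom, "On ASEP with Step Bernoulli
Initial Condition": for `0 < |τ| < 1` and `|λ| > |τ|^{1-m}`, the series
`∑_{k=m}^{∞} [k-1 choose k-m]_τ τ^{(1-m)k} λ^{-k}` converges and
`(-1)^m τ^{m(m-1)/2} ∑_{k=m}^{∞} [k-1 choose k-m]_τ τ^{(1-m)k} λ^{-k}
  = ∏_{j=0}^{m-1} 1/(1 - λ τ^j)`.
(The series is indexed by `k = m + j`, `j ∈ ℕ`.) -/
theorem tau_binomial_lambda_series
    (m : ℕ) (hm : 1 ≤ m) (τ lam : ℂ) (hτ0 : 0 < ‖τ‖) (hτ1 : ‖τ‖ < 1)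
    (hlam : ‖lam‖ > ‖τ‖ ^ ((1 : ℤ) - m)) :
    Summable (fun j : ℕ =>
        tBinom τ (m + j - 1) j * τ ^ (((1 : ℤ) - m) * (m + j)) *
          lam ^ (-((m : ℤ) + j))) ∧
      (-1 : ℂ) ^ m * τ ^ (m * (m - 1) / 2) *
          ∑' j : ℕ,
            tBinom τ (m + j - 1) j * τ ^ (((1 : ℤ) - m) * (m + j)) *
              lam ^ (-((m : ℤ) + j)) =
        ∏ j ∈ Finset.range m, 1 / (1 - lam * τ ^ j) := by
  obtain ⟨n, rfl⟩ : ∃ n, m = n + 1 := ⟨m - 1, by omega⟩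
  have hτ : τ ≠ 0 := norm_pos_iff.mp hτ0
  have hexp : (1 : ℤ) - ((n + 1 : ℕ) : ℤ) = -(n : ℤ) := by push_cast; ring
  rw [hexp, zpow_neg, zpow_natCast] at hlam
  have hlam0 : lam ≠ 0 := norm_pos_iff.mp (lt_trans (by positivity) hlam)
  obtain ⟨z, hz⟩ : ∃ z, z = (τ ^ n * lam)⁻¹ := ⟨_, rfl⟩
  have hz0 : z ≠ 0 := by rw [hz]; positivity
  have hlamz : lam = (τ ^ n * z)⁻¹ := by rw [hz]; field_simp
  have hz1 : ‖z‖ < 1 := by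
    rw [hz, norm_inv, norm_mul, norm_pow]
    exact inv_lt_one_of_one_lt₀ ((inv_lt_iff_one_lt_mul₀' (by positivity)).mp hlam)
  have hterm : (fun j : ℕ => tBinom τ (n + 1 + j - 1) j *
      τ ^ (((1 : ℤ) - (n + 1 : ℕ)) * ((n + 1 : ℕ) + j)) * lam ^ (-(((n + 1 : ℕ) : ℤ) + j))) =
      fun j : ℕ => z ^ (n + 1) * (tBinom τ (n + j) j * z ^ j) := by
    funext j
    have hpow : τ ^ (-(n : ℤ) * (((n + 1 : ℕ) : ℤ) + j)) * lam ^ (-(((n + 1 : ℕ) : ℤ) + j)) =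
        z ^ (n + 1) * z ^ j := by
      rw [neg_mul, ← mul_neg, zpow_mul, ← mul_zpow, zpow_natCast, ← Nat.cast_add, zpow_neg,
        zpow_natCast, ← inv_pow, ← hz, pow_add]
    rw [hexp, mul_assoc, hpow, show n + 1 + j - 1 = n + j by omega]
    ring
  obtain ⟨hsum, htsum⟩ := tBinom_series hτ1 hz1 n
  rw [hterm]
  refine ⟨hsum.of_norm.mul_left _, ?_⟩
  rw [tsum_mul_left, htsum, hlamz, prod_one_div_one_sub_inv_mul hτ hz0, Nat.add_sub_cancel]
  ring
end
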